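/- arXiv:0807.4808 — 4 statements merged into one kernel-verified Lean document; each statement's English description precedes it below -/
import Mathlib

section
/- There exists ε > 0 such that for all real x with |x| < ε, F(1/4, -1/12; 2/3; x(x+4)^3 / (4(2x-1)^3)) = (1-2x)^(-1/4). -/
open Real

/-- The Gauss hypergeometric series `F(a,b;c;z) = ∑ ((a)_n (b)_n / ((c)_n n!)) z^n`,
where `(q)_n` is the rising (Pochhammer) factorial. -/
noncomputable def hypgeo (a b c z : ℝ) : ℝ :=
  ∑' n : ℕ, ((∏ i ∈ Finset.range n, (a + i)) * (∏ i ∈ Finset.range n, (b + i)) /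
    ((∏ i ∈ Finset.range n, (c + i)) * (Nat.factorial n))) * z ^ n

open Filter Topology

/-- Termwise differentiation of a one-variable power series. -/
lemma hasFPowerSeriesOnBall_deriv {f : ℝ → ℝ} {p : FormalMultilinearSeries ℝ ℝ ℝ} {r : ENNReal}
    (h : HasFPowerSeriesOnBall f p 0 r) :
    ∃ q : FormalMultilinearSeries ℝ ℝ ℝ, HasFPowerSeriesOnBall (deriv f) q 0 r ∧
      ∀ n : ℕ, q.coeff n = (n + 1) * p.coeff (n + 1) := by
  refine ⟨(ContinuousLinearMap.apply ℝ ℝ (1 : ℝ)).compFormalMultilinearSeries p.derivSeries,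
    ?_, fun n => ?_⟩
  · exact (ContinuousLinearMap.apply ℝ ℝ (1 : ℝ)).comp_hasFPowerSeriesOnBall h.fderiv
  · have := p.derivSeries_coeff_one n
    rw [nsmul_eq_mul] at this
    push_cast at this
    rw [← this]
    rfl

lemma hasSum_coeff_mul_pow {f : ℝ → ℝ} {p : FormalMultilinearSeries ℝ ℝ ℝ} {r : ENNReal}
    (h : HasFPowerSeriesOnBall f p 0 r) {z : ℝ} (hz : z ∈ Metric.eball (0 : ℝ) r) :
    HasSum (fun n => p.coeff n * z ^ n) (f z) := by
  have := h.hasSum hz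
  simpa [mul_comm] using this

lemma hasSum_mul_pow_shift {v w : ℕ → ℝ} {z S : ℝ} (h : HasSum (fun n => w n * z ^ n) S)
    (h0 : v 0 = 0) (hv : ∀ n, v (n + 1) = w n) : HasSum (fun n => v n * z ^ n) (z * S) := by
  have t : HasSum (fun n => v (n + 1) * z ^ (n + 1)) (z * S) :=
    (h.mul_left z).congr_fun fun n => by rw [hv]; ring
  simpa [h0] using (hasSum_nat_add_iff (f := fun n => v n * z ^ n) 1).1 t

/-- The coefficients of the Gauss hypergeometric series. -/
noncomputable def hypgeoCoeff (a b c : ℝ) (n : ℕ) : ℝ :=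
  (∏ i ∈ Finset.range n, (a + i)) * (∏ i ∈ Finset.range n, (b + i)) /
    ((∏ i ∈ Finset.range n, (c + i)) * (Nat.factorial n))

lemma hypgeoCoeff_succ {a b c : ℝ} (hc : ∀ n : ℕ, c + n ≠ 0) (n : ℕ) :
    (c + n) * (n + 1) * hypgeoCoeff a b c (n + 1) = (a + n) * (b + n) * hypgeoCoeff a b c n := by
  have h1 := hc n
  have h2 : ∏ i ∈ Finset.range n, (c + i) ≠ 0 := Finset.prod_ne_zero_iff.2 fun i _ => hc i
  have h3 : (Nat.factorial n : ℝ) ≠ 0 := by positivity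
  have h4 : (n : ℝ) + 1 ≠ 0 := by positivity
  simp only [hypgeoCoeff, Finset.prod_range_succ, Nat.factorial_succ, Nat.cast_mul, Nat.cast_add,
    Nat.cast_one]
  field_simp

lemma prod_range_add_eq_ascPochhammer_eval (a : ℝ) (n : ℕ) :
    ∏ i ∈ Finset.range n, (a + i) = (ascPochhammer ℝ n).eval a := by
  induction n with
  | zero => simp
  | succ n ih => rw [Finset.prod_range_succ, ih, ascPochhammer_succ_eval]

lemma hypgeoCoeff_eq (a b c : ℝ) : hypgeoCoeff a b c = ordinaryHypergeometricCoefficient a b c := by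
  ext n
  simp only [hypgeoCoeff, prod_range_add_eq_ascPochhammer_eval, ordinaryHypergeometricCoefficient,
    div_eq_mul_inv, mul_inv]
  ring

lemma hypgeo_hasFPowerSeriesOnBall {a b c : ℝ}
    (habc : ∀ n : ℕ, (n : ℝ) ≠ -a ∧ (n : ℝ) ≠ -b ∧ (n : ℝ) ≠ -c) :
    HasFPowerSeriesOnBall (hypgeo a b c)
      (FormalMultilinearSeries.ofScalars ℝ (hypgeoCoeff a b c)) 0 1 := by
  have hr := ordinaryHypergeometricSeries_radius_eq_one (𝕂 := ℝ) ℝ a b c habc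
  have hs : ordinaryHypergeometricSeries ℝ a b c =
      FormalMultilinearSeries.ofScalars ℝ (hypgeoCoeff a b c) := by
    rw [hypgeoCoeff_eq]; rfl
  rw [hs] at hr
  have h := (FormalMultilinearSeries.ofScalars ℝ (hypgeoCoeff a b c)).hasFPowerSeriesOnBall
    (by rw [hr]; exact one_pos)
  rw [hr] at h
  convert h using 1
  ext z
  simp [hypgeo, hypgeoCoeff, FormalMultilinearSeries.sum, mul_comm]

/-- The hypergeometric differential equation. -/
lemma hypgeo_ode {a b c : ℝ}
    (habc : ∀ n : ℕ, (n : ℝ) ≠ -a ∧ (n : ℝ) ≠ -b ∧ (n : ℝ) ≠ -c) {z : ℝ} (hz : |z| < 1) :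
    z * (1 - z) * deriv (deriv (hypgeo a b c)) z + (c - (a + b + 1) * z) * deriv (hypgeo a b c) z
      - a * b * hypgeo a b c z = 0 := by
  have hF := hypgeo_hasFPowerSeriesOnBall habc
  obtain ⟨q, hq, hqc⟩ := hasFPowerSeriesOnBall_deriv hF
  obtain ⟨s, hs, hsc⟩ := hasFPowerSeriesOnBall_deriv hq
  have hz' : z ∈ Metric.eball (0 : ℝ) 1 := by
    rw [← ENNReal.ofReal_one, Metric.eball_ofReal]; simpa using hz
  have e0 := hasSum_coeff_mul_pow hF hz'
  have e1 := hasSum_coeff_mul_pow hq hz'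
  have e2 := hasSum_coeff_mul_pow hs hz'
  simp only [hsc, hqc, FormalMultilinearSeries.coeff_ofScalars] at e0 e1 e2
  set u := hypgeoCoeff a b c with hu
  have z1 : HasSum (fun n : ℕ => n * u n * z ^ n) (z * deriv (hypgeo a b c) z) :=
    hasSum_mul_pow_shift e1 (by simp) (fun n => by push_cast; ring)
  have z2 : HasSum (fun n : ℕ => n * (n + 1) * u (n + 1) * z ^ n)
      (z * deriv (deriv (hypgeo a b c)) z) :=
    hasSum_mul_pow_shift e2 (by simp) (fun n => by push_cast; ring)
  have z3 : HasSum (fun n : ℕ => n * (n - 1) * u n * z ^ n)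
      (z * (z * deriv (deriv (hypgeo a b c)) z)) :=
    hasSum_mul_pow_shift z2 (by simp) (fun n => by push_cast; ring)
  have key := (((z2.sub z3).add (e1.mul_left c)).sub (z1.mul_left (a + b + 1))).sub
    (e0.mul_left (a * b))
  have : ∀ n : ℕ, (n * (n + 1) * u (n + 1) * z ^ n - n * (n - 1) * u n * z ^ n
      + c * ((n + 1) * u (n + 1) * z ^ n) - (a + b + 1) * (n * u n * z ^ n)
      - a * b * (u n * z ^ n)) = 0 := fun n => by
    have := hypgeoCoeff_succ (a := a) (b := b) (c := c)
      (fun n h => (habc n).2.2 (by linarith)) n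
    rw [← hu] at this
    linear_combination z ^ n * this
  have := key.unique ((hasSum_zero (α := ℝ) (β := ℕ)).congr_fun this)
  linear_combination this

/-- At a regular singular point whose nonzero exponent is not a positive integer, an analytic
solution that vanishes at the point is identically zero. -/
lemma eventually_eq_zero_of_regular_singular {f P Q R : ℝ → ℝ} (hf : AnalyticAt ℝ f 0)
    (hf0 : f 0 = 0) (hP : ContinuousAt P 0) (hQ : ContinuousAt Q 0) (hR : ContinuousAt R 0)
    (hPQ : ∀ n : ℕ, n * P 0 + Q 0 ≠ 0)
    (hode : ∀ᶠ x in 𝓝 0, x * P x * deriv (deriv f) x + Q x * deriv f x + R x * f x = 0) :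
    ∀ᶠ x in 𝓝 0, f x = 0 := by
  by_contra hne
  obtain ⟨k, h, hh, hh0, hfh⟩ := hf.exists_eventuallyEq_pow_smul_nonzero_iff.2 hne
  simp only [sub_zero, smul_eq_mul] at hfh
  obtain _ | m := k
  · have := hfh.self_of_nhds
    simp_all
  have hfh : f =ᶠ[𝓝 0] fun x => x ^ (m + 1) * h x := hfh
  have d1 : deriv f =ᶠ[𝓝 0] fun x => (m + 1) * x ^ m * h x + x ^ (m + 1) * deriv h x := by
    refine hfh.deriv.trans ?_
    filter_upwards [hh.eventually_analyticAt] with x hx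
    have := (hasDerivAt_pow (m + 1) x).mul hx.differentiableAt.hasDerivAt
    refine (this.congr_deriv ?_).deriv
    simp
  have d2 : ∀ᶠ x in 𝓝 0, x * deriv (deriv f) x =
      x ^ m * ((m + 1) * m * h x + 2 * (m + 1) * x * deriv h x + x ^ 2 * deriv (deriv h) x) := by
    filter_upwards [d1.deriv, hh.eventually_analyticAt] with x hx1 hx
    have h1 := hx.differentiableAt.hasDerivAt
    have h2 := hx.deriv.differentiableAt.hasDerivAt
    have := (((hasDerivAt_pow m x).const_mul ((m : ℝ) + 1)).mul h1).add
      ((hasDerivAt_pow (m + 1) x).mul h2)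
    rw [hx1]
    refine (congrArg (x * ·) this.deriv).trans ?_
    obtain _ | l := m
    · simp; ring
    · simp; ring
  have hzero : ∀ᶠ x in 𝓝[≠] (0 : ℝ), P x * ((m + 1) * m * h x + 2 * (m + 1) * x * deriv h x
      + x ^ 2 * deriv (deriv h) x) + Q x * ((m + 1) * h x + x * deriv h x)
      + R x * (x * h x) = 0 := by
    filter_upwards [nhdsWithin_le_nhds hode, nhdsWithin_le_nhds d1, nhdsWithin_le_nhds d2,
      nhdsWithin_le_nhds hfh, self_mem_nhdsWithin] with x e h1 h2 h3 hx
    rw [h1, h3] at e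
    have hx : x ^ m ≠ 0 := pow_ne_zero _ hx
    apply mul_left_cancel₀ hx
    linear_combination e - P x * h2
  have hcont : ContinuousAt (fun x => P x * ((m + 1) * m * h x + 2 * (m + 1) * x * deriv h x
      + x ^ 2 * deriv (deriv h) x) + Q x * ((m + 1) * h x + x * deriv h x)
      + R x * (x * h x)) 0 := by
    have c0 := hh.continuousAt
    have c1 := hh.deriv.continuousAt
    have c2 := hh.deriv.deriv.continuousAt
    fun_prop
  have hlim := tendsto_nhds_unique (hcont.tendsto.mono_left nhdsWithin_le_nhds)
    (tendsto_const_nhds.congr' (hzero.mono fun x hx => hx.symm))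
  have : ((m : ℝ) + 1) * h 0 * (m * P 0 + Q 0) = 0 := by
    simp at hlim
    linear_combination hlim
  have hm : (m : ℝ) + 1 ≠ 0 := by positivity
  exact mul_ne_zero (mul_ne_zero hm hh0) (hPQ m) this

lemma hasDerivAt_argument {x : ℝ} (hx : 2 * x - 1 ≠ 0) :
    HasDerivAt (fun x : ℝ => x * (x + 4) ^ 3 / (4 * (2 * x - 1) ^ 3))
      ((x + 4) ^ 2 * (x ^ 2 - 10 * x - 2) / (2 * (2 * x - 1) ^ 4)) x := by
  have h4 : HasDerivAt (fun x : ℝ => x + 4) 1 x := (hasDerivAt_id x).add_const 4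
  have h1 : HasDerivAt (fun x : ℝ => 2 * x - 1) (2 * 1) x :=
    ((hasDerivAt_id x).const_mul 2).sub_const 1
  refine (((hasDerivAt_id x).mul (h4.pow 3)).div ((h1.pow 3).const_mul 4)
    (mul_ne_zero four_ne_zero (pow_ne_zero 3 hx))).congr_deriv ?_
  simp
  field_simp
  ring

lemma hasDerivAt_argument_deriv {x : ℝ} (hx : 2 * x - 1 ≠ 0) :
    HasDerivAt (fun x : ℝ => (x + 4) ^ 2 * (x ^ 2 - 10 * x - 2) / (2 * (2 * x - 1) ^ 4))
      (27 * (x + 4) * (5 * x + 2) / (2 * x - 1) ^ 5) x := by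
  have h4 : HasDerivAt (fun x : ℝ => x + 4) 1 x := (hasDerivAt_id x).add_const 4
  have h1 : HasDerivAt (fun x : ℝ => 2 * x - 1) (2 * 1) x :=
    ((hasDerivAt_id x).const_mul 2).sub_const 1
  have h2 : HasDerivAt (fun x : ℝ => x ^ 2 - 10 * x - 2) (2 * x - 10) x := by
    simpa using (((hasDerivAt_pow 2 x).sub ((hasDerivAt_id x).const_mul 10)).sub_const 2)
  refine (((h4.pow 2).mul h2).div ((h1.pow 4).const_mul 2)
    (mul_ne_zero two_ne_zero (pow_ne_zero 4 hx))).congr_deriv ?_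
  simp
  field_simp
  ring

lemma hasDerivAt_one_sub_rpow {x : ℝ} (hx : 2 * x - 1 < 0) :
    HasDerivAt (fun x : ℝ => (1 - 2 * x) ^ ((-1 : ℝ) / 4))
      (-((1 - 2 * x) ^ ((-1 : ℝ) / 4) / (2 * (2 * x - 1)))) x := by
  have h1 : HasDerivAt (fun x : ℝ => 1 - 2 * x) (-(2 * 1)) x :=
    ((hasDerivAt_id x).const_mul 2).const_sub 1
  have hpos : 0 < 1 - 2 * x := by linarith
  refine (h1.rpow_const (p := (-1 : ℝ) / 4) (Or.inl hpos.ne')).congr_deriv ?_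
  rw [Real.rpow_sub_one hpos.ne']
  have := hx.ne
  have := hpos.ne'
  field_simp
  ring

lemma one_sub_rpow_ode {x : ℝ} (hx : 2 * x - 1 ≠ 0) (g : ℝ) :
    x * (x + 4) ^ 3 / (4 * (2 * x - 1) ^ 3) * (1 - x * (x + 4) ^ 3 / (4 * (2 * x - 1) ^ 3)) *
        (((x + 4) ^ 2 * (x ^ 2 - 10 * x - 2) /
          (2 * (2 * x - 1) ^ 4)) * (5 / 4 * (g / (2 * x - 1) ^ 2))
          - (27 * (x + 4) * (5 * x + 2) / (2 * x - 1) ^ 5) * -(g / (2 * (2 * x - 1))))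
          + (2 / 3 - (1 / 4 + -1 / 12 + 1) * (x * (x + 4) ^ 3 / (4 * (2 * x - 1) ^ 3))) *
          ((x + 4) ^ 2 * (x ^ 2 - 10 * x - 2) /
          (2 * (2 * x - 1) ^ 4)) ^ 2 * -(g / (2 * (2 * x - 1)))
          - 1 / 4 * (-1 / 12) * ((x + 4) ^ 2 * (x ^ 2 - 10 * x - 2) /
          (2 * (2 * x - 1) ^ 4)) ^ 3 * g = 0 := by
  obtain ⟨t, rfl⟩ : ∃ t, x = (t + 1) / 2 := ⟨2 * x - 1, by ring⟩
  have ht : 2 * ((t + 1) / 2) - 1 = t := by ring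
  rw [ht] at hx ⊢
  field_simp
  ring

theorem stmt0 : ∃ ε > 0, ∀ x : ℝ, |x| < ε →
    hypgeo (1/4) (-1/12) (2/3) (x * (x + 4)^3 / (4 * (2*x - 1)^3)) =
      (1 - 2*x) ^ ((-1 : ℝ)/4) := by
  have habc : ∀ n : ℕ, (n : ℝ) ≠ -(1/4) ∧ (n : ℝ) ≠ -(-1/12) ∧ (n : ℝ) ≠ -(2/3) := by
    intro n
    have hn : (0 : ℝ) ≤ n := n.cast_nonneg
    refine ⟨by linarith, fun h => ?_, by linarith⟩
    have : ((12 * n : ℕ) : ℝ) = (1 : ℕ) := by push_cast; linarith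
    have := Nat.cast_injective this
    omega
  set F := hypgeo (1/4) (-1/12) (2/3) with hF
  set φ : ℝ → ℝ := fun x => x * (x + 4) ^ 3 / (4 * (2 * x - 1) ^ 3) with hφ
  set G : ℝ → ℝ := fun x => (1 - 2 * x) ^ ((-1 : ℝ) / 4) with hG
  have hps : HasFPowerSeriesOnBall F _ 0 1 := hypgeo_hasFPowerSeriesOnBall habc
  have hFan : ∀ z, |z| < 1 → AnalyticAt ℝ F z := fun z hz =>
    hps.analyticAt_of_mem (by rw [← ENNReal.ofReal_one, Metric.eball_ofReal]; simpa using hz)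
  have hφan : AnalyticAt ℝ φ 0 := by
    have : (4 * (2 * (0 : ℝ) - 1) ^ 3) ≠ 0 := by norm_num
    simp only [hφ]
    fun_prop (disch := assumption)
  have hφ0 : φ 0 = 0 := by simp [hφ]
  have hGan : AnalyticAt ℝ G 0 := by
    simp only [hG]
    exact (ContDiffAt.rpow_const_of_ne (by fun_prop) (by norm_num)).analyticAt
  have hneg : ∀ᶠ x in 𝓝 (0 : ℝ), 2 * x - 1 < 0 := by
    have : ContinuousAt (fun x : ℝ => 2 * x - 1) 0 := by fun_prop
    exact this.eventually_lt continuousAt_const (by norm_num)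
  have hsmall : ∀ᶠ x in 𝓝 (0 : ℝ), |φ x| < 1 :=
    hφan.continuousAt.abs.eventually_lt continuousAt_const (by simp [hφ0])
  have hFφan : AnalyticAt ℝ (fun x => F (φ x)) 0 :=
    AnalyticAt.comp (hFan _ (by simp [hφ0])) hφan
  have hY1 : deriv (fun x => F (φ x) - G x) =ᶠ[𝓝 0] fun x =>
      deriv F (φ x) * ((x + 4) ^ 2 * (x ^ 2 - 10 * x - 2) / (2 * (2 * x - 1) ^ 4))
        - -(G x / (2 * (2 * x - 1))) := by
    filter_upwards [hneg, hsmall] with x hx hs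
    exact (((hFan _ hs).differentiableAt.hasDerivAt.comp x (hasDerivAt_argument hx.ne)).sub
      (hasDerivAt_one_sub_rpow hx)).deriv
  have hY2 : ∀ᶠ x in 𝓝 0, deriv (deriv (fun x => F (φ x) - G x)) x =
      deriv (deriv F) (φ x) * ((x + 4) ^ 2 * (x ^ 2 - 10 * x - 2) / (2 * (2 * x - 1) ^ 4)) ^ 2
        + deriv F (φ x) * (27 * (x + 4) * (5 * x + 2) / (2 * x - 1) ^ 5)
        - 5 / 4 * (G x / (2 * x - 1) ^ 2) := by
    filter_upwards [hY1.deriv, hneg, hsmall] with x h hx hs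
    have h1 : HasDerivAt (fun x : ℝ => 2 * (2 * x - 1)) (2 * (2 * 1)) x :=
      (((hasDerivAt_id x).const_mul 2).sub_const 1).const_mul 2
    have hx' := hx.ne
    rw [h]
    refine HasDerivAt.deriv (((((hFan _ hs).deriv.differentiableAt.hasDerivAt.comp x
      (hasDerivAt_argument hx')).mul (hasDerivAt_argument_deriv hx')).sub
      ((hasDerivAt_one_sub_rpow hx).div h1 (by positivity)).neg).congr_deriv ?_)
    simp only [Function.comp_apply, hG]
    have hg (g : ℝ) : (-(g / (2 * (2 * x - 1))) * (2 * (2 * x - 1)) - g * (2 * (2 * 1))) /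
        (2 * (2 * x - 1)) ^ 2 = -(5 / 4 * (g / (2 * x - 1) ^ 2)) := by
      field_simp
      ring
    rw [hg]
    ring
  have hev : ∀ᶠ x in 𝓝 0, F (φ x) - G x = 0 := by
    refine eventually_eq_zero_of_regular_singular
      (P := fun x => (x + 4) ^ 3 / (4 * (2 * x - 1) ^ 3) * (1 - φ x) *
        ((x + 4) ^ 2 * (x ^ 2 - 10 * x - 2) / (2 * (2 * x - 1) ^ 4)))
      (Q := fun x => -(φ x * (1 - φ x) * (27 * (x + 4) * (5 * x + 2) / (2 * x - 1) ^ 5))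
        + (2 / 3 - (1 / 4 + -1 / 12 + 1) * φ x) *
          ((x + 4) ^ 2 * (x ^ 2 - 10 * x - 2) / (2 * (2 * x - 1) ^ 4)) ^ 2)
      (R := fun x => -(1 / 4 * (-1 / 12)) *
          ((x + 4) ^ 2 * (x ^ 2 - 10 * x - 2) / (2 * (2 * x - 1) ^ 4)) ^ 3)
      (hFφan.sub hGan) ?_ ?_ ?_ ?_ ?_ ?_
    · have hF0 : F 0 = 1 := by
        rw [hF, hypgeo, tsum_eq_single 0 (fun n hn => by simp [hn])]
        simp
      simp [hφ0, hG, hF0]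
    · have := hφan.continuousAt
      fun_prop (disch := norm_num)
    · have := hφan.continuousAt
      fun_prop (disch := norm_num)
    · fun_prop (disch := norm_num)
    · intro n
      have hn : (0 : ℝ) ≤ n := n.cast_nonneg
      simp only [hφ0]
      norm_num
      positivity
    · filter_upwards [hY1, hY2, hneg, hsmall] with x h1 h2 hx hs
      have ode := hypgeo_ode habc hs
      rw [← hF] at ode
      rw [h1, h2]
      have hx' := hx.ne
      have hφx : φ x = x * ((x + 4) ^ 3 / (4 * (2 * x - 1) ^ 3)) := by
        simp only [hφ]; ring
      have hGode : φ x * (1 - φ x) * (((x + 4) ^ 2 * (x ^ 2 - 10 * x - 2) /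
          (2 * (2 * x - 1) ^ 4)) * (5 / 4 * (G x / (2 * x - 1) ^ 2))
          - (27 * (x + 4) * (5 * x + 2) / (2 * x - 1) ^ 5) * -(G x / (2 * (2 * x - 1))))
          + (2 / 3 - (1 / 4 + -1 / 12 + 1) * φ x) * ((x + 4) ^ 2 * (x ^ 2 - 10 * x - 2) /
          (2 * (2 * x - 1) ^ 4)) ^ 2 * -(G x / (2 * (2 * x - 1)))
          - 1 / 4 * (-1 / 12) * ((x + 4) ^ 2 * (x ^ 2 - 10 * x - 2) /
          (2 * (2 * x - 1) ^ 4)) ^ 3 * G x = 0 := by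
        simpa only [hφ] using one_sub_rpow_ode hx' (G x)
      generalize (x + 4) ^ 2 * (x ^ 2 - 10 * x - 2) / (2 * (2 * x - 1) ^ 4) = w at *
      generalize 27 * (x + 4) * (5 * x + 2) / (2 * x - 1) ^ 5 = v at *
      have hx2 : x * ((x + 4) ^ 3 / (4 * (2 * x - 1) ^ 3) * (1 - φ x) * w) =
          φ x * (1 - φ x) * w := by
        rw [← mul_assoc, ← mul_assoc, ← hφx]
      rw [hx2]
      linear_combination w ^ 3 * ode - hGode
  obtain ⟨ε, hε, h⟩ := Metric.eventually_nhds_iff.1 hev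
  exact ⟨ε, hε, fun x hx => sub_eq_zero.1 (h (by simpa using hx))⟩
end

section
/- There exists ε > 0 such that for all real x with |x| < ε, F(5/4, -1/12; 5/3; x(x+4)^3 / (4(2x-1)^3)) = ((1+x) / (1 + x/4)^2) · (1-2x)^(-1/4). -/
open Real

open Filter Topology

/-- If `f` is the sum of a power series, its derivative is the sum of the termwise derivative. -/
lemma HasFPowerSeriesOnBall.exists_deriv {f : ℝ → ℝ} {p : FormalMultilinearSeries ℝ ℝ ℝ}
    {x : ℝ} {r : ENNReal} (h : HasFPowerSeriesOnBall f p x r) :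
    ∃ q : FormalMultilinearSeries ℝ ℝ ℝ, HasFPowerSeriesOnBall (deriv f) q x r ∧
      ∀ n, q.coeff n = (n + 1) * p.coeff (n + 1) := by
  refine ⟨_, (ContinuousLinearMap.apply ℝ ℝ (1 : ℝ)).comp_hasFPowerSeriesOnBall h.fderiv, ?_⟩
  intro n
  have := p.derivSeries_coeff_one n
  rw [nsmul_eq_mul] at this
  exact_mod_cast this

lemma HasSum.mul_pow_shift {u : ℕ → ℝ} {z s : ℝ} (h : HasSum (fun n => u n * z ^ n) s)
    {v : ℕ → ℝ} (hv0 : v 0 = 0) (hv : ∀ n, v (n + 1) = u n) :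
    HasSum (fun n => v n * z ^ n) (z * s) := by
  rw [← hasSum_nat_add_iff' 1]
  simp only [Finset.range_one, Finset.sum_singleton, hv0, zero_mul, sub_zero, hv]
  have h' := h.mul_left z
  have e : (fun n => z * (u n * z ^ n)) = fun n => u n * z ^ (n + 1) := by
    funext n
    ring
  rwa [e] at h'

/-- The hypergeometric differential equation, for a power series whose coefficients satisfy
the hypergeometric recurrence. -/
lemma HasFPowerSeriesOnBall.hypergeometric_ode {f : ℝ → ℝ} {p : FormalMultilinearSeries ℝ ℝ ℝ}
    {r : ENNReal} (h : HasFPowerSeriesOnBall f p 0 r) {a b c : ℝ}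
    (hp : ∀ n : ℕ, (n + 1) * (c + n) * p.coeff (n + 1) = (a + n) * (b + n) * p.coeff n)
    {z : ℝ} (hz : z ∈ Metric.eball (0 : ℝ) r) :
    z * (1 - z) * deriv (deriv f) z + (c - (a + b + 1) * z) * deriv f z - a * b * f z = 0 := by
  obtain ⟨q, hq, hqc⟩ := h.exists_deriv
  obtain ⟨t, ht, htc⟩ := hq.exists_deriv
  have h0 := h.hasSum hz
  have h1 := hq.hasSum hz
  have h2 := ht.hasSum hz
  simp only [FormalMultilinearSeries.apply_eq_pow_smul_coeff, smul_eq_mul, zero_add,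
    mul_comm (z ^ _), htc, hqc] at h0 h1 h2
  have h1z := h1.mul_pow_shift (v := fun n => n * p.coeff n) (by simp) (fun n => by simp)
  have h2z := h2.mul_pow_shift (v := fun n => n * ((n + 1) * p.coeff (n + 1))) (by simp)
    (fun n => by simp)
  have h2zz := h2z.mul_pow_shift (v := fun n => n * ((n - 1) * p.coeff n)) (by simp)
    (fun n => by push_cast; ring)
  have key := (((h2z.sub h2zz).add (h1.mul_left c)).sub (h1z.mul_left (a + b + 1))).sub
    (h0.mul_left (a * b))
  have hterm : ∀ n : ℕ, n * ((n + 1) * p.coeff (n + 1)) * z ^ n -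
      n * ((n - 1) * p.coeff n) * z ^ n + c * ((n + 1) * p.coeff (n + 1) * z ^ n) -
      (a + b + 1) * (n * p.coeff n * z ^ n) - a * b * (p.coeff n * z ^ n) = 0 := fun n => by
    linear_combination z ^ n * hp n
  simp only [hterm] at key
  linear_combination key.unique hasSum_zero

lemma hypgeo_eq_ordinaryHypergeometric (a b c z : ℝ) :
    hypgeo a b c z = ordinaryHypergeometric a b c z := by
  have hasc : ∀ (q : ℝ) (n : ℕ),
      (ascPochhammer ℝ n).eval q = ∏ i ∈ Finset.range n, (q + i) := by
    intro q n
    induction n with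
    | zero => simp
    | succ n ih => rw [ascPochhammer_succ_eval, ih, Finset.prod_range_succ]
  rw [hypgeo, ordinaryHypergeometric_eq_tsum]
  refine tsum_congr fun n => ?_
  simp only [hasc, smul_eq_mul]
  rw [div_eq_mul_inv, mul_inv]
  ring

/-- A regular singular second-order linear equation has no nonzero analytic solution vanishing
at the singular point, if no positive integer is an exponent. -/
lemma AnalyticAt.eventually_eq_zero_of_regular_singular_ode {D D₁ D₂ p q r : ℝ → ℝ}
    (hD : AnalyticAt ℝ D 0) (hD0 : D 0 = 0)
    (hD₁ : ∀ᶠ x in 𝓝 0, HasDerivAt D (D₁ x) x) (hD₂ : ∀ᶠ x in 𝓝 0, HasDerivAt D₁ (D₂ x) x)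
    (hp : ContinuousAt p 0) (hq : ContinuousAt q 0) (hr : ContinuousAt r 0)
    (hode : ∀ᶠ x in 𝓝 0, x * p x * D₂ x + q x * D₁ x + r x * D x = 0)
    (hne : ∀ n : ℕ, n * p 0 + q 0 ≠ 0) : ∀ᶠ x in 𝓝 0, D x = 0 := by
  by_contra hcon
  obtain ⟨n, g, hg, hg0, hDg⟩ := hD.exists_eventuallyEq_pow_smul_nonzero_iff.mpr hcon
  simp only [sub_zero, smul_eq_mul] at hDg
  obtain _ | m := n
  · have := hDg.self_of_nhds
    simp [hD0] at this
    exact hg0 this.symm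
  have hg1 : ∀ᶠ x in 𝓝 0, HasDerivAt g (deriv g x) x :=
    hg.eventually_analyticAt.mono fun x hx => hx.differentiableAt.hasDerivAt
  have hg2 : ∀ᶠ x in 𝓝 0, HasDerivAt (deriv g) (deriv (deriv g) x) x :=
    hg.deriv.eventually_analyticAt.mono fun x hx => hx.differentiableAt.hasDerivAt
  have e1 : ∀ᶠ x in 𝓝 0, D₁ x = x ^ m * ((m + 1) * g x + x * deriv g x) := by
    filter_upwards [hg1, hD₁, hDg.eventually_nhds] with x h1 h2 h3
    refine h2.unique (HasDerivAt.congr_of_eventuallyEq ?_ h3)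
    refine ((hasDerivAt_pow (m + 1) x).mul h1).congr_deriv ?_
    rw [add_tsub_cancel_right]
    push_cast
    ring
  have e2 : ∀ᶠ x in 𝓝 0, x * D₂ x = x ^ m * (m * ((m + 1) * g x + x * deriv g x) +
      x * ((m + 2) * deriv g x + x * deriv (deriv g) x)) := by
    filter_upwards [hg1, hg2, hD₂, e1.eventually_nhds] with x h1 h2 h3 h4
    have h5 := h3.unique (HasDerivAt.congr_of_eventuallyEq ((hasDerivAt_pow m x).mul
      ((h1.const_mul ((m : ℝ) + 1)).add ((hasDerivAt_id x).mul h2))) h4)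
    have h6 : (m : ℝ) * (x * x ^ (m - 1)) = m * x ^ m := by
      obtain _ | k := m
      · simp
      · rw [add_tsub_cancel_right, pow_succ']
    simp only [Pi.add_apply, Pi.mul_apply, id] at h5
    rw [h5]
    linear_combination ((m + 1) * g x + x * deriv g x) * h6
  let B : ℝ → ℝ := fun x => p x * (m * ((m + 1) * g x + x * deriv g x) +
    x * ((m + 2) * deriv g x + x * deriv (deriv g) x)) +
    q x * ((m + 1) * g x + x * deriv g x) + r x * (x * g x)
  have hB : ∀ᶠ x in 𝓝[≠] (0 : ℝ), B x = 0 := by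
    filter_upwards [hode.filter_mono nhdsWithin_le_nhds, e1.filter_mono nhdsWithin_le_nhds,
      e2.filter_mono nhdsWithin_le_nhds, hDg.filter_mono nhdsWithin_le_nhds,
      self_mem_nhdsWithin] with x h1 h2 h3 h4 hx
    have hx' : x ^ m ≠ 0 := pow_ne_zero _ hx
    refine (mul_eq_zero.mp (?_ : x ^ m * B x = 0)).resolve_left hx'
    rw [h2, h4] at h1
    simp only [B]
    linear_combination h1 - p x * h3
  have hBc : ContinuousAt B 0 := by
    have := hg.continuousAt
    have := hg.deriv.continuousAt
    have := hg.deriv.deriv.continuousAt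
    fun_prop
  have hB0 : B 0 = 0 := tendsto_nhds_unique (hBc.tendsto.mono_left nhdsWithin_le_nhds)
    (tendsto_const_nhds.congr' (hB.mono fun x hx => hx.symm))
  have : ((m : ℝ) + 1) * g 0 * (m * p 0 + q 0) = 0 := by
    simp only [B] at hB0
    linear_combination hB0
  have hm : (m : ℝ) + 1 ≠ 0 := by positivity
  exact (mul_ne_zero (mul_ne_zero hm hg0) (hne m)) this

theorem stmt1 : ∃ ε > 0, ∀ x : ℝ, |x| < ε →
    hypgeo (5/4) (-1/12) (5/3) (x * (x + 4)^3 / (4 * (2*x - 1)^3)) =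
      ((1 + x) / (1 + x/4)^2) * (1 - 2*x) ^ ((-1 : ℝ)/4) := by
  let F : ℝ → ℝ := ordinaryHypergeometric (5/4 : ℝ) (-1/12) (5/3)
  let P := ordinaryHypergeometricSeries ℝ (5/4 : ℝ) (-1/12) (5/3)
  have hrad : P.radius = 1 := by
    apply ordinaryHypergeometricSeries_radius_eq_one
    intro k
    have hk : (0 : ℝ) ≤ k := k.cast_nonneg
    refine ⟨by linarith, fun h => ?_, by linarith⟩
    have h12 : (12 * k : ℝ) = 1 := by linarith
    have : 12 * k = 1 := by exact_mod_cast h12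
    omega
  have hF : HasFPowerSeriesOnBall F P 0 1 := by
    rw [← hrad]
    exact P.hasFPowerSeriesOnBall (by rw [hrad]; exact one_pos)
  have hrec : ∀ n : ℕ, ((n : ℝ) + 1) * (5/3 + n) * P.coeff (n + 1) =
      (5/4 + n) * (-1/12 + n) * P.coeff n := by
    intro n
    simp only [P, ordinaryHypergeometricSeries, FormalMultilinearSeries.coeff_ofScalars,
      ordinaryHypergeometricCoefficient, ascPochhammer_succ_eval, Nat.factorial_succ]
    have hc : (5/3 + n : ℝ) ≠ 0 := by positivity
    have hn : ((n : ℝ) + 1) ≠ 0 := by positivity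
    push_cast
    rw [mul_inv, mul_inv]
    field_simp
  have hFan : AnalyticAt ℝ F 0 := hF.analyticAt
  let φ : ℝ → ℝ := fun x => x * (x + 4)^3 / (4 * (2*x - 1)^3)
  let φ₁ : ℝ → ℝ := fun x => (x^2 - 10*x - 2) * (x + 4)^2 / (2 * (2*x - 1)^4)
  let φ₂ : ℝ → ℝ := fun x => (x + 4) * ((2*x - 10) * (x + 4) * (2*x - 1) +
    (x^2 - 10*x - 2) * (2 * (2*x - 1) - 8 * (x + 4))) / (2 * (2*x - 1)^5)
  let u : ℝ → ℝ := fun x => (1 - 2*x) ^ ((-1 : ℝ)/4)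
  let R : ℝ → ℝ := fun x => (1 + x) / (1 + x/4)^2
  let R₁ : ℝ → ℝ := fun x => 8 * (5*x^2 - 5*x + 8) / ((1 - 2*x) * (x + 4)^3)
  let R₂ : ℝ → ℝ := fun x => 8 * ((10*x - 5) * (1 - 2*x) * (x + 4) +
    (5*x^2 - 5*x + 8) * (5/2 * (x + 4) - 3 * (1 - 2*x))) / ((1 - 2*x)^2 * (x + 4)^4)
  have hsmall : ∀ᶠ x : ℝ in 𝓝 0, -(1/4) < x ∧ x < 1/4 :=
    Ioo_mem_nhds (by norm_num) (by norm_num)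
  have hφan : AnalyticAt ℝ φ 0 := by
    have : (4 * (2 * (0 : ℝ) - 1) ^ 3) ≠ 0 := by norm_num
    fun_prop (disch := assumption)
  have hφ0 : φ 0 = 0 := by simp [φ]
  have hφt : Tendsto φ (𝓝 0) (𝓝 0) := by simpa [hφ0] using hφan.continuousAt.tendsto
  have hφ' : ∀ᶠ x in 𝓝 0, HasDerivAt φ (φ₁ x) x := by
    filter_upwards [hsmall] with x hx
    have h1 : 2*x - 1 ≠ 0 := by linarith
    refine HasDerivAt.congr_deriv (((hasDerivAt_id x).mul (((hasDerivAt_id x).add_const 4).pow 3)).div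
      (((((hasDerivAt_id x).const_mul 2).sub_const 1).pow 3).const_mul 4)
      (by simpa using h1)) ?_
    simp [φ₁]
    field_simp
    ring
  have hφ'' : ∀ᶠ x in 𝓝 0, HasDerivAt φ₁ (φ₂ x) x := by
    filter_upwards [hsmall] with x hx
    have h1 : 2*x - 1 ≠ 0 := by linarith
    refine HasDerivAt.congr_deriv ((((((hasDerivAt_id x).pow 2).sub ((hasDerivAt_id x).const_mul 10)).sub_const 2).mul
      (((hasDerivAt_id x).add_const 4).pow 2)).div
      (((((hasDerivAt_id x).const_mul 2).sub_const 1).pow 4).const_mul 2)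
      (by simpa using h1)) ?_
    simp [φ₂]
    field_simp
    ring
  have hu : ∀ᶠ x in 𝓝 0, HasDerivAt u (u x / (2 * (1 - 2*x))) x := by
    filter_upwards [hsmall] with x hx
    have h1 : 0 < 1 - 2*x := by linarith
    refine HasDerivAt.congr_deriv ((((hasDerivAt_id x).const_mul 2).const_sub 1).rpow_const
      (p := (-1 : ℝ)/4) (Or.inl (by simpa using h1.ne'))) ?_
    simp only [u, id]
    rw [Real.rpow_sub_one h1.ne']
    field_simp
    norm_num
  have hH₁ : ∀ᶠ x in 𝓝 0, HasDerivAt (fun x => R x * u x) (R₁ x * u x) x := by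
    filter_upwards [hsmall, hu] with x hx hux
    have h1 : 1 - 2*x ≠ 0 := by linarith
    have h2 : 1 + x/4 ≠ 0 := by linarith
    have h3 : x + 4 ≠ 0 := by linarith
    refine HasDerivAt.congr_deriv ((((hasDerivAt_id x).const_add 1).div
      ((((hasDerivAt_id x).div_const 4).const_add 1).pow 2) (by simpa using h2)).mul hux) ?_
    have h4 : 1 + x/4 = (x + 4)/4 := by ring
    simp [R₁, h4]
    obtain ⟨s, hs⟩ : ∃ s, s = x + 4 := ⟨_, rfl⟩
    obtain ⟨t, ht⟩ : ∃ t, t = 1 - 2*x := ⟨_, rfl⟩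
    rw [← hs] at h3 ⊢
    rw [← ht] at h1 ⊢
    field_simp
    rw [hs, ht]
    ring
  have hH₂ : ∀ᶠ x in 𝓝 0, HasDerivAt (fun x => R₁ x * u x) (R₂ x * u x) x := by
    filter_upwards [hsmall, hu] with x hx hux
    have h1 : 1 - 2*x ≠ 0 := by linarith
    have h3 : x + 4 ≠ 0 := by linarith
    refine HasDerivAt.congr_deriv (((((((((hasDerivAt_id x).pow 2).const_mul 5).sub
      ((hasDerivAt_id x).const_mul 5)).add_const 8).const_mul 8).div
      ((((hasDerivAt_id x).const_mul 2).const_sub 1).mul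
      (((hasDerivAt_id x).add_const 4).pow 3)) (by simp [h1, h3]))).mul hux) ?_
    simp [R₂]
    field_simp
    ring
  have hG₁ : ∀ᶠ x in 𝓝 0, HasDerivAt (fun x => F (φ x)) (deriv F (φ x) * φ₁ x) x := by
    filter_upwards [hφ', hφt.eventually hFan.eventually_analyticAt] with x h1 h2
    exact h2.differentiableAt.hasDerivAt.comp x h1
  have hG₂ : ∀ᶠ x in 𝓝 0, HasDerivAt (fun x => deriv F (φ x) * φ₁ x)
      (deriv (deriv F) (φ x) * φ₁ x * φ₁ x + deriv F (φ x) * φ₂ x) x := by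
    filter_upwards [hφ', hφ'', hφt.eventually hFan.deriv.eventually_analyticAt] with x h1 h2 h3
    exact (h3.differentiableAt.hasDerivAt.comp x h1).mul h2
  have hFode : ∀ᶠ x in 𝓝 0, φ x * (1 - φ x) * deriv (deriv F) (φ x) +
      (5/3 - (5/4 + -1/12 + 1) * φ x) * deriv F (φ x) - 5/4 * (-1/12) * F (φ x) = 0 := by
    filter_upwards [hφt.eventually (Metric.eball_mem_nhds (0 : ℝ) one_pos)] with x hx
    exact hF.hypergeometric_ode hrec hx
  have hφc : ContinuousAt φ 0 := hφan.continuousAt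
  have hφ₁c : ContinuousAt φ₁ 0 := hφ''.self_of_nhds.continuousAt
  have hφ₂c : ContinuousAt φ₂ 0 := by
    have : (2 * (2 * (0 : ℝ) - 1) ^ 5) ≠ 0 := by norm_num
    fun_prop (disch := assumption)
  have hwc : ContinuousAt (fun x : ℝ => (x + 4)^3 / (4 * (2*x - 1)^3)) 0 := by
    have : (4 * (2 * (0 : ℝ) - 1) ^ 3) ≠ 0 := by norm_num
    fun_prop (disch := assumption)
  have hHan : AnalyticAt ℝ (fun x => R x * u x) 0 := by
    have h1 : (1 + (0 : ℝ) / 4) ^ 2 ≠ 0 := by norm_num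
    have h2 : (0 : ℝ) < 1 - 2 * 0 := by norm_num
    have hR : AnalyticAt ℝ R 0 := by fun_prop (disch := assumption)
    have hu' : AnalyticAt ℝ u 0 := by
      have : AnalyticAt ℝ (fun x : ℝ => 1 - 2 * x) 0 := by fun_prop
      refine ((this.log h2).mul (analyticAt_const (v := (-1 : ℝ)/4))).rexp.congr ?_
      filter_upwards [hsmall] with x hx
      have h1 : 0 < 1 - 2*x := by linarith
      simp [u, Real.rpow_def_of_pos h1]
    exact hR.mul hu'
  have hzero : ∀ᶠ x in 𝓝 0, F (φ x) - R x * u x = 0 := by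
    refine AnalyticAt.eventually_eq_zero_of_regular_singular_ode
      (D := fun x => F (φ x) - R x * u x)
      (p := fun x => (x + 4)^3 / (4 * (2*x - 1)^3) * (1 - φ x) * φ₁ x)
      (q := fun x => (5/3 - 13/6 * φ x) * φ₁ x ^ 2 - φ x * (1 - φ x) * φ₂ x)
      (r := fun x => 5/48 * φ₁ x ^ 3)
      ((hFan.comp_of_eq hφan hφ0).sub hHan) ?_
      ((hG₁.and hH₁).mono fun x hx => hx.1.sub hx.2)
      ((hG₂.and hH₂).mono fun x hx => hx.1.sub hx.2)
      (by fun_prop) (by fun_prop) (by fun_prop) ?_ ?_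
    · simp [hφ0, F, R, u]
    · filter_upwards [hFode, hsmall] with x h1 hx
      have hH : x * ((x + 4)^3 / (4 * (2*x - 1)^3) * (1 - φ x) * φ₁ x) * R₂ x +
          ((5/3 - 13/6 * φ x) * φ₁ x ^ 2 - φ x * (1 - φ x) * φ₂ x) * R₁ x +
          5/48 * φ₁ x ^ 3 * R x = 0 := by
        have h2 : 1 + x/4 ≠ 0 := by linarith
        have h3 : x + 4 ≠ 0 := by linarith
        have h4 : 2*x - 1 ≠ 0 := by linarith
        have h5 : 1 - 2*x = -(2*x - 1) := by ring
        have h6 : 1 + x/4 = (x + 4)/4 := by ring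
        simp only [φ, φ₁, φ₂, R, R₁, R₂, h5, h6]
        obtain ⟨s, hs⟩ : ∃ s, s = x + 4 := ⟨_, rfl⟩
        obtain ⟨t, ht⟩ : ∃ t, t = 2*x - 1 := ⟨_, rfl⟩
        rw [← hs] at h3 ⊢
        rw [← ht] at h4 ⊢
        field_simp
        rw [hs, ht]
        ring
      have hw : φ x = x * ((x + 4)^3 / (4 * (2*x - 1)^3)) := by simp only [φ]; ring
      generalize (x + 4)^3 / (4 * (2*x - 1)^3) = w at hw hH ⊢
      linear_combination (φ₁ x)^3 * h1 - u x * hH -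
        (1 - φ x) * φ₁ x ^ 3 * deriv (deriv F) (φ x) * hw -
        (1 - φ x) * φ₁ x * φ₂ x * deriv F (φ x) * hw
    · intro n
      have : (0 : ℝ) ≤ n := n.cast_nonneg
      norm_num [φ, φ₁, φ₂]
      positivity
  obtain ⟨ε, hε, h⟩ := Metric.eventually_nhds_iff.mp hzero
  refine ⟨ε, hε, fun x hx => ?_⟩
  rw [hypgeo_eq_ordinaryHypergeometric]
  exact sub_eq_zero.mp (h (by simpa using hx))
end

section
/- There exists ε > 0 such that for all real x with |x| < ε, F(1/4, -5/12; 1/3; x(x+4)^3 / (4(2x-1)^3)) = (1 + (5/2)x) · (1-2x)^(-5/4). -/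
open Real

open Filter Topology

/-- A solution of `x p y'' + q y' + s y = 0`, analytic at the regular singular point `0` and
vanishing there, is identically zero nearby if no positive integer is a root of the indicial
polynomial. -/
theorem eventually_eq_zero_of_regular_singular_s3 {K K₁ K₂ p q s : ℝ → ℝ}
    (hK : AnalyticAt ℝ K 0) (h0 : K 0 = 0)
    (hp : ContinuousAt p 0) (hq : ContinuousAt q 0) (hs : ContinuousAt s 0)
    (hind : ∀ m : ℕ, 1 ≤ m → (m : ℝ) * (m - 1) * p 0 + m * q 0 ≠ 0)
    (hK₁ : ∀ᶠ x in 𝓝 0, HasDerivAt K (K₁ x) x)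
    (hK₂ : ∀ᶠ x in 𝓝 0, HasDerivAt K₁ (K₂ x) x)
    (hode : ∀ᶠ x in 𝓝 0, x * p x * K₂ x + q x * K₁ x + s x * K x = 0) :
    ∀ᶠ x in 𝓝 0, K x = 0 := by
  by_contra hne
  obtain ⟨m, g, hg, hg0, hKg⟩ := hK.exists_eventuallyEq_pow_smul_nonzero_iff.mpr hne
  simp only [sub_zero, smul_eq_mul] at hKg
  have hm : m ≠ 0 := by
    rintro rfl
    have := hKg.self_of_nhds
    simp only [pow_zero, one_mul] at this
    exact hg0 (this ▸ h0)
  have hgd : ∀ᶠ x in 𝓝 (0 : ℝ), HasDerivAt g (deriv g x) x :=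
    hg.eventually_analyticAt.mono fun x hx => hx.differentiableAt.hasDerivAt
  have hgd' : ∀ᶠ x in 𝓝 (0 : ℝ), HasDerivAt (deriv g) (deriv (deriv g) x) x :=
    hg.deriv.eventually_analyticAt.mono fun x hx => hx.differentiableAt.hasDerivAt
  have h1 : ∀ᶠ x in 𝓝 (0 : ℝ), K₁ x = m * x ^ (m - 1) * g x + x ^ m * deriv g x := by
    filter_upwards [hK₁, hKg.eventually_nhds, hgd] with x hx hx' hx''
    exact hx.unique (((hasDerivAt_pow m x).mul hx'').congr_of_eventuallyEq hx')
  have h2 : ∀ᶠ x in 𝓝 (0 : ℝ), K₂ x = (m * (((m - 1 : ℕ) : ℝ) * x ^ (m - 1 - 1)) * g x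
      + m * x ^ (m - 1) * deriv g x)
      + (m * x ^ (m - 1) * deriv g x + x ^ m * deriv (deriv g) x) := by
    filter_upwards [hK₂, h1.eventually_nhds, hgd, hgd'] with x hx hx' h3 h4
    exact hx.unique (((((hasDerivAt_pow (m - 1) x).const_mul (m : ℝ)).mul h3).add
      ((hasDerivAt_pow m x).mul h4)).congr_of_eventuallyEq hx')
  set G : ℝ → ℝ := fun x =>
    p x * (m * (m - 1) * g x + 2 * m * x * deriv g x + x ^ 2 * deriv (deriv g) x)
      + q x * (m * g x + x * deriv g x) + s x * x * g x with hG
  have hGc : ContinuousAt G 0 := by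
    have c0 := hg.continuousAt
    have c1 := hg.deriv.continuousAt
    have c2 := hg.deriv.deriv.continuousAt
    fun_prop
  have hG0 : ∀ᶠ x in 𝓝[≠] (0 : ℝ), G x = 0 := by
    filter_upwards [hode.filter_mono nhdsWithin_le_nhds, h1.filter_mono nhdsWithin_le_nhds,
      h2.filter_mono nhdsWithin_le_nhds, hKg.filter_mono nhdsWithin_le_nhds,
      self_mem_nhdsWithin] with x e e1 e2 e3 hx
    have hx : x ≠ 0 := hx
    rw [e1, e2, e3] at e
    have : x ^ m * G x = 0 := by
      rw [← mul_zero x, ← e, hG]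
      obtain ⟨k, rfl⟩ := Nat.exists_eq_succ_of_ne_zero hm
      rcases k with _ | k
      · simp only [Nat.succ_eq_add_one, Nat.zero_add, Nat.sub_self]
        push_cast
        ring
      · simp only [Nat.succ_eq_add_one, Nat.add_sub_cancel]
        push_cast
        ring
    exact (mul_eq_zero.mp this).resolve_left (pow_ne_zero _ hx)
  have hG00 : G 0 = 0 :=
    tendsto_nhds_unique (hGc.tendsto.mono_left nhdsWithin_le_nhds)
      (tendsto_const_nhds.congr' (hG0.mono fun _ h => h.symm))
  apply mul_ne_zero (hind m (Nat.one_le_iff_ne_zero.mpr hm)) hg0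
  simp only [hG] at hG00
  linear_combination hG00

theorem summable_mul_pow_of_polynomial_bound {u : ℕ → ℝ} {k : ℕ} {C : ℝ}
    (hu : ∀ n, |u n| ≤ C * ((n : ℝ) + 1) ^ k) {z : ℝ} (hz : |z| < 1) :
    Summable fun n => u n * z ^ n := by
  rcases eq_or_ne z 0 with rfl | hz0
  · exact summable_of_ne_finset_zero (s := {0}) fun n hn => by
      simp [Finset.notMem_singleton.mp hn]
  have h := summable_pow_mul_geometric_of_norm_lt_one k (r := |z|) (by simpa using hz)
  have h' := ((summable_nat_add_iff 1).mpr h).mul_left (C * |z|⁻¹)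
  refine Summable.of_norm_bounded h' fun n => ?_
  have : |z| ≠ 0 := abs_ne_zero.mpr hz0
  rw [Real.norm_eq_abs, abs_mul, abs_pow]
  calc |u n| * |z| ^ n ≤ C * ((n : ℝ) + 1) ^ k * |z| ^ n := by gcongr; exact hu n
    _ = _ := by push_cast; rw [pow_succ]; field_simp

theorem abs_succ_mul_succ_le {u : ℕ → ℝ} {k : ℕ} {C : ℝ} (hC : 0 ≤ C)
    (hu : ∀ n, |u n| ≤ C * ((n : ℝ) + 1) ^ k) (n : ℕ) :
    |((n : ℝ) + 1) * u (n + 1)| ≤ C * 2 ^ k * ((n : ℝ) + 1) ^ (k + 1) := by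
  rw [abs_mul, abs_of_pos (by positivity : (0 : ℝ) < n + 1)]
  have h := hu (n + 1)
  push_cast at h
  calc ((n : ℝ) + 1) * |u (n + 1)| ≤ (n + 1) * (C * (2 * ((n : ℝ) + 1)) ^ k) := by
        gcongr
        refine h.trans ?_
        gcongr
        linarith [(Nat.cast_nonneg n : (0 : ℝ) ≤ n)]
    _ = _ := by rw [mul_pow]; ring

theorem hasDerivAt_tsum_mul_pow {u : ℕ → ℝ} {k : ℕ} {C : ℝ} (hC : 0 ≤ C)
    (hu : ∀ n, |u n| ≤ C * ((n : ℝ) + 1) ^ k) {z : ℝ} (hz : |z| < 1) :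
    HasDerivAt (fun y => ∑' n, u n * y ^ n) (∑' n : ℕ, ((n : ℝ) + 1) * u (n + 1) * z ^ n) z := by
  obtain ⟨r, hzr, hr1⟩ := exists_between hz
  have hr0 : 0 < r := (abs_nonneg z).trans_lt hzr
  have hdu := abs_succ_mul_succ_le hC hu
  have hs : ∀ y : ℝ, |y| < 1 → Summable fun n : ℕ => |u n * ((n : ℝ) * y ^ (n - 1))| := by
    intro y hy
    rw [← summable_nat_add_iff 1]
    refine (summable_mul_pow_of_polynomial_bound hdu hy).abs.congr fun n => ?_
    simp only [Nat.add_sub_cancel]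
    push_cast
    ring_nf
  have key := hasDerivAt_tsum_of_isPreconnected (g := fun n y => u n * y ^ n)
    (g' := fun n y => u n * ((n : ℝ) * y ^ (n - 1))) (y₀ := z) (y := z)
    (hs r (by rwa [abs_of_pos hr0])) Metric.isOpen_ball (convex_ball (0 : ℝ) r).isPreconnected
    (fun n y _ => (hasDerivAt_pow n y).const_mul (u n))
    (fun n y hy => ?_) (by simpa using hzr) (summable_mul_pow_of_polynomial_bound hu hz)
    (by simpa using hzr)
  · convert! key using 1
    rw [(hs z hz).of_abs.tsum_eq_zero_add]
    simp only [Nat.cast_zero, zero_mul, mul_zero, zero_add, Nat.add_sub_cancel]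
    refine tsum_congr fun n => ?_
    push_cast
    ring
  · have hy : |y| < r := by simpa using hy
    rw [Real.norm_eq_abs, abs_mul, abs_mul, abs_mul, abs_mul, abs_pow, abs_pow, abs_of_pos hr0]
    gcongr

theorem analyticAt_tsum_mul_pow {u : ℕ → ℝ} {C : ℝ} (hu : ∀ n, |u n| ≤ C) :
    AnalyticAt ℝ (fun y => ∑' n, u n * y ^ n) 0 := by
  have hr : 0 < (FormalMultilinearSeries.ofScalars ℝ u).radius :=
    zero_lt_one.trans_le <| by
      simpa using FormalMultilinearSeries.le_radius_of_bound
        (FormalMultilinearSeries.ofScalars ℝ u) C (r := 1) fun n => by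
          simpa [FormalMultilinearSeries.ofScalars_norm] using hu n
  have h := (FormalMultilinearSeries.hasFPowerSeriesOnBall _ hr).analyticAt
  convert h using 1
  ext y
  rw [← FormalMultilinearSeries.ofScalarsSum, FormalMultilinearSeries.ofScalars_sum_eq]
  simp

theorem hasSum_mul_shift {u : ℕ → ℝ} {z S : ℝ} (h : HasSum (fun n => u (n + 1) * z ^ n) S)
    (h0 : u 0 = 0) : HasSum (fun n => u n * z ^ n) (z * S) := by
  rw [← hasSum_nat_add_iff' 1]
  simpa [h0, pow_succ, mul_comm, mul_left_comm, mul_assoc] using h.mul_left z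

/-- The hypergeometric differential equation for power series satisfying the hypergeometric
recurrence. -/
theorem hypergeometric_ode {u : ℕ → ℝ} {a b c C : ℝ} (hC : 0 ≤ C) (hu : ∀ n, |u n| ≤ C)
    (hrec : ∀ n : ℕ, ((n : ℝ) + 1) * (n + c) * u (n + 1) = (n + a) * (n + b) * u n) :
    ∃ F₁ F₂ : ℝ → ℝ,
      (∀ y, |y| < 1 → HasDerivAt (fun y => ∑' n, u n * y ^ n) (F₁ y) y) ∧
      (∀ y, |y| < 1 → HasDerivAt F₁ (F₂ y) y) ∧
      ∀ y, |y| < 1 → y * (1 - y) * F₂ y + (c - (a + b + 1) * y) * F₁ y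
        - a * b * ∑' n, u n * y ^ n = 0 := by
  have hu0 : ∀ n : ℕ, |u n| ≤ C * ((n : ℝ) + 1) ^ 0 := by simpa using hu
  have hu1 := abs_succ_mul_succ_le hC hu0
  have hu2 := abs_succ_mul_succ_le (by positivity) hu1
  refine ⟨_, _, fun y hy => hasDerivAt_tsum_mul_pow hC hu0 hy,
    fun y hy => hasDerivAt_tsum_mul_pow (by positivity) hu1 hy, fun y hy => ?_⟩
  have s0 := (summable_mul_pow_of_polynomial_bound hu0 hy).hasSum
  have s1 := (summable_mul_pow_of_polynomial_bound hu1 hy).hasSum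
  have s2 := (summable_mul_pow_of_polynomial_bound hu2 hy).hasSum
  have t1 : HasSum (fun n : ℕ => (n : ℝ) * u n * y ^ n) _ :=
    hasSum_mul_shift (u := fun n => (n : ℝ) * u n) (by simpa using s1) (by simp)
  have t2 : HasSum (fun n : ℕ => (n : ℝ) * (((n : ℝ) + 1) * u (n + 1)) * y ^ n) _ :=
    hasSum_mul_shift (u := fun n => (n : ℝ) * (((n : ℝ) + 1) * u (n + 1)))
      (by simpa using s2) (by simp)
  have t3 : HasSum (fun n : ℕ => (n : ℝ) * (((n : ℝ) - 1) * u n) * y ^ n) _ :=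
    hasSum_mul_shift (u := fun n => (n : ℝ) * (((n : ℝ) - 1) * u n))
      (t2.congr_fun fun n => by push_cast; ring) (by simp)
  have := ((((t2.sub t3).add (s1.mul_left c)).sub (t1.mul_left (a + b + 1))).sub
    (s0.mul_left (a * b))).unique (hasSum_zero.congr_fun fun n => by
      linear_combination y ^ n * hrec n)
  push_cast
  linear_combination this

theorem hypgeo_coeff_succ (a b c : ℝ) (n : ℕ) (hc : ∀ i : ℕ, c + i ≠ 0) :
    ((n : ℝ) + 1) * (n + c) *
      ((∏ i ∈ Finset.range (n + 1), (a + i)) * (∏ i ∈ Finset.range (n + 1), (b + i)) /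
        ((∏ i ∈ Finset.range (n + 1), (c + i)) * (Nat.factorial (n + 1)))) =
    (n + a) * (n + b) *
      ((∏ i ∈ Finset.range n, (a + i)) * (∏ i ∈ Finset.range n, (b + i)) /
        ((∏ i ∈ Finset.range n, (c + i)) * (Nat.factorial n))) := by
  simp only [Finset.prod_range_succ, Nat.factorial_succ, Nat.cast_mul, Nat.cast_add, Nat.cast_one]
  have h1 : ∏ i ∈ Finset.range n, (c + i) ≠ 0 := Finset.prod_ne_zero_iff.mpr fun i _ => hc i
  have h2 : (Nat.factorial n : ℝ) ≠ 0 := by positivity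
  have h3 : (n : ℝ) + 1 ≠ 0 := by positivity
  have h4 := hc n
  field_simp
  ring

/-- On a neighbourhood of `0` the hypergeometric series `F(1/4, -5/12; 1/3; ·)` is analytic and
solves the hypergeometric differential equation. -/
theorem hypgeo_analyticAt_and_ode :
    AnalyticAt ℝ (hypgeo (1/4) (-5/12) (1/3)) 0 ∧ ∃ F₁ F₂ : ℝ → ℝ,
      (∀ y, |y| < 1 → HasDerivAt (hypgeo (1/4) (-5/12) (1/3)) (F₁ y) y) ∧
      (∀ y, |y| < 1 → HasDerivAt F₁ (F₂ y) y) ∧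
      ∀ y, |y| < 1 → y * (1 - y) * F₂ y + (1/3 - (1/4 + -5/12 + 1) * y) * F₁ y
        - 1/4 * (-5/12) * hypgeo (1/4) (-5/12) (1/3) y = 0 := by
  have hrec := fun n => hypgeo_coeff_succ (1/4) (-5/12) (1/3) n fun i => by positivity
  have hu : ∀ n : ℕ, |(∏ i ∈ Finset.range n, ((1/4 : ℝ) + i)) *
      (∏ i ∈ Finset.range n, ((-5/12 : ℝ) + i)) /
      ((∏ i ∈ Finset.range n, ((1/3 : ℝ) + i)) * (Nat.factorial n))| ≤ 1 := by
    intro n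
    induction n with
    | zero => simp
    | succ n ih =>
      have hn : (0 : ℝ) ≤ n := n.cast_nonneg
      have hpos : (0 : ℝ) < ((n : ℝ) + 1) * (n + 1/3) := by positivity
      have h := congrArg abs (hrec n)
      rw [abs_mul, abs_mul _ (_ / _), abs_of_pos hpos] at h
      have hle : |((n : ℝ) + 1/4) * (n + -5/12)| ≤ ((n : ℝ) + 1) * (n + 1/3) :=
        abs_le.mpr ⟨by nlinarith, by nlinarith⟩
      refine le_of_mul_le_mul_left ?_ hpos
      rw [h]
      exact mul_le_mul hle ih (abs_nonneg _) hpos.le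
  exact ⟨analyticAt_tsum_mul_pow hu, hypergeometric_ode zero_le_one hu hrec⟩

theorem hypgeo_zero (a b c : ℝ) : hypgeo a b c 0 = 1 := by
  rw [hypgeo, tsum_eq_single 0 fun n hn => by simp [hn]]
  simp

theorem stmt3 : ∃ ε > 0, ∀ x : ℝ, |x| < ε →
    hypgeo (1/4) (-5/12) (1/3) (x * (x + 4)^3 / (4 * (2*x - 1)^3)) =
      (1 + (5/2) * x) * (1 - 2*x) ^ ((-5 : ℝ)/4) := by
  obtain ⟨hF, F₁, F₂, hF₁, hF₂, hode⟩ := hypgeo_analyticAt_and_ode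
  set F := hypgeo (1/4) (-5/12) (1/3)
  set T : ℝ → ℝ := fun x => (1 - 2 * x) ^ ((-5 : ℝ)/4) with hT
  set z : ℝ → ℝ := fun x => x * (x + 4) ^ 3 / (4 * (2 * x - 1) ^ 3) with hz
  set z₁ : ℝ → ℝ := fun x => (x + 4) ^ 2 * (x ^ 2 - 10 * x - 2) / (2 * (2 * x - 1) ^ 4) with hz₁
  set z₂ : ℝ → ℝ := fun x => 27 * (x + 4) * (5 * x + 2) / (2 * x - 1) ^ 5 with hz₂
  have zan : AnalyticAt ℝ z 0 := by
    refine AnalyticAt.fun_div (by fun_prop) (by fun_prop) (by norm_num)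
  have cz := zan.continuousAt
  have cz₁ : ContinuousAt z₁ 0 :=
    ContinuousAt.div (by fun_prop) (by fun_prop) (by norm_num)
  have cz₂ : ContinuousAt z₂ 0 :=
    ContinuousAt.div (by fun_prop) (by fun_prop) (by norm_num)
  have z0 : z 0 = 0 := by simp [hz]
  have hTan : AnalyticAt ℝ T 0 :=
    ContDiffAt.analyticAt (ContDiffAt.rpow_const_of_ne (by fun_prop) (by norm_num))
  have hd : ∀ᶠ x : ℝ in 𝓝 0, 0 < 1 - 2 * x :=
    ContinuousAt.eventually_lt (by fun_prop) (by fun_prop) (by norm_num)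
  have hz1 : ∀ᶠ x in 𝓝 0, |z x| < 1 :=
    ContinuousAt.eventually_lt cz.abs continuousAt_const (by simp [z0])
  have dz : ∀ x, 0 < 1 - 2 * x → HasDerivAt z (z₁ x) x := by
    intro x hx
    have hx' : 2 * x - 1 ≠ 0 := by linarith
    have hlin : HasDerivAt (fun x : ℝ => 2 * x - 1) 2 x := by
      simpa using ((hasDerivAt_id x).const_mul 2).sub_const 1
    refine (((hasDerivAt_id x).mul (((hasDerivAt_id x).add_const 4).pow 3)).div
      ((hlin.pow 3).const_mul 4) (mul_ne_zero four_ne_zero (pow_ne_zero 3 hx'))).congr_deriv ?_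
    simp only [hz₁, id, Pi.pow_apply, Pi.mul_apply]
    generalize hδ : 2 * x - 1 = δ at hx' ⊢
    field_simp
    subst hδ
    ring
  have dz₁ : ∀ x, 0 < 1 - 2 * x → HasDerivAt z₁ (z₂ x) x := by
    intro x hx
    have hx' : 2 * x - 1 ≠ 0 := by linarith
    have hlin : HasDerivAt (fun x : ℝ => 2 * x - 1) 2 x := by
      simpa using ((hasDerivAt_id x).const_mul 2).sub_const 1
    refine (((((hasDerivAt_id x).add_const 4).pow 2).mul
      (((hasDerivAt_pow 2 x).sub ((hasDerivAt_id x).const_mul 10)).sub_const 2)).div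
      ((hlin.pow 4).const_mul 2) (mul_ne_zero two_ne_zero (pow_ne_zero 4 hx'))).congr_deriv ?_
    simp only [hz₂, id, Pi.pow_apply, Pi.mul_apply, Pi.sub_apply]
    generalize hδ : 2 * x - 1 = δ at hx' ⊢
    field_simp
    subst hδ
    ring
  have dT : ∀ x, 0 < 1 - 2 * x → HasDerivAt T (-(5/2) * T x / (2 * x - 1)) x := by
    intro x hx
    have hx' : 2 * x - 1 ≠ 0 := by linarith
    have hlin : HasDerivAt (fun x : ℝ => 1 - 2 * x) (-2) x := by
      simpa using ((hasDerivAt_id x).const_mul 2).const_sub 1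
    refine (hlin.rpow_const (p := (-5 : ℝ)/4) (Or.inl hx.ne')).congr_deriv ?_
    rw [Real.rpow_sub_one hx.ne']
    simp only [hT]
    rw [show 2 * x - 1 = -(1 - 2 * x) by ring]
    field_simp
    ring
  have key := eventually_eq_zero_of_regular_singular_s3
    (K := fun x => F (z x) - (1 + (5/2) * x) * T x)
    (K₁ := fun x => F₁ (z x) * z₁ x - -(5/4) * (x + 4) * T x / (2 * x - 1))
    (K₂ := fun x => F₂ (z x) * z₁ x ^ 2 + F₁ (z x) * z₂ x
      - (5/4) * (19 + 5/2 * x) * T x / (2 * x - 1) ^ 2)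
    (p := fun x => (x + 4) ^ 3 / (4 * (2 * x - 1) ^ 3) * (1 - z x) * z₁ x)
    (q := fun x => (1/3 - 5/6 * z x) * z₁ x ^ 2 - z x * (1 - z x) * z₂ x)
    (s := fun x => 5/48 * z₁ x ^ 3)
    (((z0.symm ▸ hF : AnalyticAt ℝ F (z 0)).comp zan).sub
      (AnalyticAt.mul (by fun_prop) hTan))
    (by simp [z0, hT, F, hypgeo_zero])
    (((ContinuousAt.div (by fun_prop) (by fun_prop) (by norm_num)).mul (by fun_prop)).mul cz₁)
    (by fun_prop) (by fun_prop) ?_ ?_ ?_ ?_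
  · obtain ⟨ε, hε, h⟩ := Metric.eventually_nhds_iff.mp key
    exact ⟨ε, hε, fun x hx => sub_eq_zero.mp (h (by simpa using hx))⟩
  · intro m hm
    have hm' : (1 : ℝ) ≤ m := by exact_mod_cast hm
    have : (0 : ℝ) < m * (m - 1) * 256 + m * (256/3) := by nlinarith
    refine ne_of_gt (this.trans_eq ?_)
    simp only [z0, hz₁]
    norm_num
  · filter_upwards [hd, hz1] with x hx hx1
    have hx' : 2 * x - 1 ≠ 0 := by linarith
    have hlin : HasDerivAt (fun x : ℝ => 1 + 5/2 * x) (5/2) x := by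
      simpa using ((hasDerivAt_id x).const_mul (5/2)).const_add 1
    refine (((hF₁ _ hx1).comp x (dz x hx)).sub (hlin.mul (dT x hx))).congr_deriv ?_
    field_simp
    ring
  · filter_upwards [hd, hz1] with x hx hx1
    have hx' : 2 * x - 1 ≠ 0 := by linarith
    have hlin : HasDerivAt (fun x : ℝ => -(5/4) * (x + 4)) (-(5/4)) x := by
      simpa using ((hasDerivAt_id x).add_const 4).const_mul (-(5/4))
    have hlin' : HasDerivAt (fun x : ℝ => 2 * x - 1) 2 x := by
      simpa using ((hasDerivAt_id x).const_mul 2).sub_const 1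
    refine ((((hF₂ _ hx1).comp x (dz x hx)).mul (dz₁ x hx)).sub
      ((hlin.mul (dT x hx)).div hlin' hx')).congr_deriv ?_
    simp only [Function.comp, Pi.mul_apply]
    generalize hδ : 2 * x - 1 = δ at hx' ⊢
    field_simp
    subst hδ
    ring
  · filter_upwards [hd, hz1] with x hx hx1
    have hx' : 2 * x - 1 ≠ 0 := by linarith
    have e := hode _ hx1
    have hR : z x * (1 - z x) * z₁ x * ((5/4) * (19 + 5/2 * x) * T x / (2 * x - 1) ^ 2)
        + ((1/3 - 5/6 * z x) * z₁ x ^ 2 - z x * (1 - z x) * z₂ x)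
          * (-(5/4) * (x + 4) * T x / (2 * x - 1))
        + 5/48 * z₁ x ^ 3 * ((1 + (5/2) * x) * T x) = 0 := by
      generalize T x = t
      simp only [hz, hz₁, hz₂]
      generalize hδ : 2 * x - 1 = δ at hx' ⊢
      field_simp
      subst hδ
      ring
    have hxz : x * ((x + 4) ^ 3 / (4 * (2 * x - 1) ^ 3)) = z x := by simp only [hz]; ring
    linear_combination z₁ x ^ 3 * e - hR + (1 - z x) * z₁ x * (F₂ (z x) * z₁ x ^ 2
      + F₁ (z x) * z₂ x - (5/4) * (19 + 5/2 * x) * T x / (2 * x - 1) ^ 2) * hxz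
end

section
/- Let φ₁(x) = 1728·x·(x^2-11x-1)^5 / (x^4+228x^3+494x^2-228x+1)^3. There exists ε > 0 such that for all real x with |x| < ε, F(19/60, -1/60; 4/5; φ₁(x)) = (1 - 228x + 494x^2 + 228x^3 + x^4)^(-1/20). -/
open Real

open Filter Topology

section HypergeometricEquation

variable {a b c : ℝ} {h : ℝ → ℝ}

/-- The `n`-th derivative of a solution of the hypergeometric equation with parameters `a, b, c`
solves the hypergeometric equation with parameters `a + n, b + n, c + n`. -/
lemma iteratedDeriv_hypergeometric_equation (hh : AnalyticAt ℝ h 0)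
    (ode : ∀ᶠ z in 𝓝 (0 : ℝ), z * (1 - z) * deriv (deriv h) z +
      (c - (a + b + 1) * z) * deriv h z - a * b * h z = 0) (n : ℕ) :
    ∀ᶠ z in 𝓝 (0 : ℝ), z * (1 - z) * iteratedDeriv (n + 2) h z +
      (c + n - (a + b + 1 + 2 * n) * z) * iteratedDeriv (n + 1) h z -
      (a + n) * (b + n) * iteratedDeriv n h z = 0 := by
  induction n with
  | zero =>
    filter_upwards [ode] with z hz
    simp only [iteratedDeriv_succ, iteratedDeriv_zero, Nat.cast_zero]
    linear_combination hz
  | succ n ih =>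
    filter_upwards [ih.eventually_nhds, hh.eventually_analyticAt] with z hz haz
    have hd (k : ℕ) : HasDerivAt (iteratedDeriv k h) (iteratedDeriv (k + 1) h z) z := by
      rw [iteratedDeriv_succ]
      exact iteratedDeriv_eq_iterate (𝕜 := ℝ) (f := h) ▸ (haz.iterated_deriv k).differentiableAt.hasDerivAt
    have hid := hasDerivAt_id z
    have key := (((hid.mul (hid.const_sub 1)).mul (hd (n + 2))).add
      (((hid.const_mul (a + b + 1 + 2 * n)).const_sub (c + n)).mul (hd (n + 1)))).sub
      ((hd n).const_mul ((a + n) * (b + n)))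
    have hzero := key.unique ((hasDerivAt_const z (0 : ℝ)).congr_of_eventuallyEq hz)
    simp only [id, Pi.mul_apply] at hzero
    push_cast
    linear_combination hzero

/-- The hypergeometric series is the unique analytic solution of the hypergeometric equation
with value `1` at `0`. -/
lemma eventually_hypgeo_eq (hh : AnalyticAt ℝ h 0) (h0 : h 0 = 1) (hc : ∀ n : ℕ, c + n ≠ 0)
    (ode : ∀ᶠ z in 𝓝 (0 : ℝ), z * (1 - z) * deriv (deriv h) z +
      (c - (a + b + 1) * z) * deriv h z - a * b * h z = 0) :
    ∀ᶠ z in 𝓝 (0 : ℝ), hypgeo a b c z = h z := by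
  have coeff (n : ℕ) : iteratedDeriv n h 0 =
      (∏ i ∈ Finset.range n, (a + i)) * (∏ i ∈ Finset.range n, (b + i)) /
        ∏ i ∈ Finset.range n, (c + i) := by
    induction n with
    | zero => simp [h0]
    | succ n ih =>
      have hrec := (iteratedDeriv_hypergeometric_equation hh ode n).self_of_nhds
      have hp : ∏ i ∈ Finset.range n, (c + i) ≠ 0 := Finset.prod_ne_zero_iff.2 fun i _ => hc i
      have hn := hc n
      rw [ih] at hrec
      simp only [Finset.prod_range_succ]
      field_simp at hrec ⊢
      linear_combination hrec
  have hs := hh.hasFPowerSeriesAt.eventually_hasSum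
  filter_upwards [hs] with z hz
  rw [zero_add] at hz
  rw [hypgeo, ← hz.tsum_eq]
  refine tsum_congr fun n => ?_
  rw [FormalMultilinearSeries.ofScalars_apply_eq, coeff, smul_eq_mul, div_div]

end HypergeometricEquation

/-- Derivative of `G` in the local coordinate `φ`, expressed through a local inverse `ψ`. -/
lemma eventually_hasDerivAt_comp_inverse {φ φ' ψ G G' : ℝ → ℝ} (hψ : AnalyticAt ℝ ψ 0)
    (hψ0 : ψ 0 = 0) (hinv : ∀ᶠ z in 𝓝 (0 : ℝ), φ (ψ z) = z)
    (hφ : ∀ᶠ x in 𝓝 (0 : ℝ), HasDerivAt φ (φ' x) x ∧ φ' x ≠ 0)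
    (hG : ∀ᶠ x in 𝓝 (0 : ℝ), HasDerivAt G (G' x) x) :
    ∀ᶠ z in 𝓝 (0 : ℝ), HasDerivAt (G ∘ ψ) (G' (ψ z) / φ' (ψ z)) z := by
  have ht : Tendsto ψ (𝓝 0) (𝓝 0) := by simpa [hψ0] using hψ.continuousAt.tendsto
  filter_upwards [hinv.eventually_nhds, ht.eventually hφ, ht.eventually hG,
    hψ.eventually_analyticAt] with z h1 h2 h3 h4
  have hd := HasDerivAt.of_local_left_inverse h4.continuousAt h2.1 h2.2 h1
  simpa [div_eq_mul_inv] using h3.comp z hd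

/-- The vertex form of the icosahedron, dehomogenised, as a polynomial in the fifth power `x` of the
coordinate and without its factor `x`. -/
def icoVertex (x : ℝ) : ℝ := x^2 - 11*x - 1

/-- The face form of the icosahedron, dehomogenised, in the same coordinate. -/
def icoFace (x : ℝ) : ℝ := x^4 + 228*x^3 + 494*x^2 - 228*x + 1

/-- The edge form of the icosahedron, dehomogenised, in the same coordinate. -/
def icoEdge (x : ℝ) : ℝ := x^6 - 522*x^5 - 10005*x^4 - 10005*x^2 + 522*x + 1

/-- The icosahedral covering map. -/
noncomputable def icoMap (x : ℝ) : ℝ := 1728 * x * icoVertex x ^ 5 / icoFace x ^ 3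

/-- The derivative of `icoFace`. -/
def icoFace' (x : ℝ) : ℝ := 4*x^3 + 684*x^2 + 988*x - 228

lemma hasDerivAt_icoVertex (x : ℝ) : HasDerivAt icoVertex (2*x - 11) x := by
  have h := hasDerivAt_id x
  refine HasDerivAt.congr_deriv (((h.pow 2).sub (h.const_mul 11)).sub_const 1) ?_
  simp

lemma hasDerivAt_icoFace (x : ℝ) : HasDerivAt icoFace (icoFace' x) x := by
  have h := hasDerivAt_id x
  refine HasDerivAt.congr_deriv (((((h.pow 4).add ((h.pow 3).const_mul 228)).add ((h.pow 2).const_mul 494)).sub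
    (h.const_mul 228)).add_const 1) ?_
  simp [icoFace']
  ring

lemma hasDerivAt_icoFace' (x : ℝ) : HasDerivAt icoFace' (12*x^2 + 1368*x + 988) x := by
  have h := hasDerivAt_id x
  refine HasDerivAt.congr_deriv (((((h.pow 3).const_mul 4).add ((h.pow 2).const_mul 684)).add (h.const_mul 988)).sub_const
    228) ?_
  simp
  ring

lemma hasDerivAt_icoEdge (x : ℝ) : HasDerivAt icoEdge
    (6*x^5 - 2610*x^4 - 40020*x^3 - 20010*x + 522) x := by
  have h := hasDerivAt_id x
  refine HasDerivAt.congr_deriv ((((((h.pow 6).sub ((h.pow 5).const_mul 522)).sub ((h.pow 4).const_mul 10005)).sub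
    ((h.pow 2).const_mul 10005)).add (h.const_mul 522)).add_const 1) ?_
  simp
  ring

/-- The syzygy between the icosahedral invariants. -/
lemma icoFace_pow_three (x : ℝ) :
    icoFace x ^ 3 = 1728 * x * icoVertex x ^ 5 + icoEdge x ^ 2 := by
  simp only [icoFace, icoVertex, icoEdge]
  ring

lemma hasDerivAt_icoMap {x : ℝ} (hx : icoFace x ≠ 0) :
    HasDerivAt icoMap (-1728 * icoVertex x ^ 4 * icoEdge x / icoFace x ^ 4) x := by
  refine HasDerivAt.congr_deriv ((((hasDerivAt_id x).const_mul 1728).mul ((hasDerivAt_icoVertex x).pow 5)).div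
    ((hasDerivAt_icoFace x).pow 3) (pow_ne_zero 3 hx)) ?_
  have key : -icoEdge x = (icoVertex x + 5 * x * (2*x - 11)) * icoFace x -
      3 * x * icoVertex x * icoFace' x := by
    simp only [icoFace, icoVertex, icoEdge, icoFace']
    ring
  simp
  field_simp
  linear_combination (-icoVertex x ^ 4) * key

lemma hasDerivAt_icoFace_rpow {x : ℝ} (hx : 0 < icoFace x) :
    HasDerivAt (fun t => icoFace t ^ ((-1 : ℝ)/20))
      (-(icoFace' x / (20 * icoFace x)) * icoFace x ^ ((-1 : ℝ)/20)) x := by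
  refine HasDerivAt.congr_deriv ((hasDerivAt_icoFace x).rpow_const (p := (-1 : ℝ)/20) (Or.inl hx.ne')) ?_
  rw [Real.rpow_sub_one hx.ne']
  field_simp

/-- The derivative of `icoFace ^ (-1/20)` with respect to `icoMap`, divided by
`icoFace ^ (-1/20)`. -/
noncomputable def icoRatio (x : ℝ) : ℝ :=
  icoFace' x * icoFace x ^ 3 / (34560 * (icoVertex x ^ 4 * icoEdge x))

/-- The derivative of `icoRatio`. -/
noncomputable def icoRatio' (x : ℝ) : ℝ :=
  (((12*x^2 + 1368*x + 988) * icoFace x ^ 3 + 3 * icoFace' x ^ 2 * icoFace x ^ 2) *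
      (icoVertex x * icoEdge x) -
    icoFace' x * icoFace x ^ 3 * (4 * (2*x - 11) * icoEdge x +
      icoVertex x * (6*x^5 - 2610*x^4 - 40020*x^3 - 20010*x + 522))) /
    (34560 * (icoVertex x ^ 5 * icoEdge x ^ 2))

lemma hasDerivAt_icoRatio {x : ℝ} (hv : icoVertex x ≠ 0) (he : icoEdge x ≠ 0) :
    HasDerivAt icoRatio (icoRatio' x) x := by
  refine HasDerivAt.congr_deriv (((hasDerivAt_icoFace' x).mul ((hasDerivAt_icoFace x).pow 3)).div
    ((((hasDerivAt_icoVertex x).pow 4).mul (hasDerivAt_icoEdge x)).const_mul 34560)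
    (mul_ne_zero (by norm_num) (mul_ne_zero (pow_ne_zero 4 hv) he))) ?_
  simp [icoRatio']
  field_simp

/-- The hypergeometric equation in the coordinate `x`, for the logarithmic derivatives of
`icoFace ^ (-1/20)`. -/
lemma icoRatio_equation {x : ℝ} (hv : icoVertex x ≠ 0) (hf : icoFace x ≠ 0) (he : icoEdge x ≠ 0) :
    icoMap x * (1 - icoMap x) *
        ((icoRatio' x - icoFace' x / (20 * icoFace x) * icoRatio x) /
          (-1728 * icoVertex x ^ 4 * icoEdge x / icoFace x ^ 4)) +
      (4/5 - (19/60 + -1/60 + 1) * icoMap x) * icoRatio x - 19/60 * (-1/60) = 0 := by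
  have h1 : 1 - icoMap x = icoEdge x ^ 2 / icoFace x ^ 3 := by
    rw [icoMap]
    field_simp
    linear_combination icoFace_pow_three x
  rw [h1]
  simp only [icoMap, icoRatio, icoRatio']
  field_simp
  simp only [icoFace, icoVertex, icoEdge, icoFace']
  ring

lemma eventually_ico_ne_zero :
    ∀ᶠ x in 𝓝 (0 : ℝ), 0 < icoFace x ∧ icoVertex x ≠ 0 ∧ icoEdge x ≠ 0 := by
  have hf := (hasDerivAt_icoFace 0).continuousAt.eventually_const_lt
    (show (0 : ℝ) < icoFace 0 by norm_num [icoFace])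
  have hv := (hasDerivAt_icoVertex 0).continuousAt.eventually_ne
    (show icoVertex 0 ≠ 0 by norm_num [icoVertex])
  have he := (hasDerivAt_icoEdge 0).continuousAt.eventually_ne
    (show icoEdge 0 ≠ 0 by norm_num [icoEdge])
  filter_upwards [hf, hv, he] with x h1 h2 h3 using ⟨h1, h2, h3⟩

lemma analyticAt_icoFace : AnalyticAt ℝ icoFace 0 := by
  unfold icoFace
  fun_prop

lemma analyticAt_icoMap : AnalyticAt ℝ icoMap 0 := by
  unfold icoMap
  refine AnalyticAt.div ?_ (analyticAt_icoFace.pow 3) (by norm_num [icoFace])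
  unfold icoVertex
  fun_prop

lemma eventually_hypgeo_icoMap :
    ∀ᶠ x in 𝓝 (0 : ℝ), hypgeo (19/60) (-1/60) (4/5) (icoMap x) = icoFace x ^ ((-1 : ℝ)/20) := by
  have h0 : icoMap 0 = 0 := by simp [icoMap]
  have hd0 := hasDerivAt_icoMap eventually_ico_ne_zero.self_of_nhds.1.ne'
  have hne : deriv icoMap 0 ≠ 0 := by
    rw [hd0.deriv]
    norm_num [icoVertex, icoEdge, icoFace]
  have hs := analyticAt_icoMap.hasStrictDerivAt
  set ψ := hs.localInverse _ _ _ hne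
  have hψ : AnalyticAt ℝ ψ 0 := by
    simpa only [h0] using analyticAt_icoMap.analyticAt_localInverse hne
  have hright : ∀ᶠ z in 𝓝 (0 : ℝ), icoMap (ψ z) = z := by
    have := HasStrictFDerivAt.eventually_right_inverse (hs.hasStrictFDerivAt_equiv hne)
    rwa [h0] at this
  have hleft : ∀ᶠ x in 𝓝 (0 : ℝ), ψ (icoMap x) = x :=
    HasStrictFDerivAt.eventually_left_inverse (hs.hasStrictFDerivAt_equiv hne)
  have hψ0 : ψ 0 = 0 := by simpa [h0] using hleft.self_of_nhds
  have ht : Tendsto ψ (𝓝 0) (𝓝 0) := by simpa [hψ0] using hψ.continuousAt.tendsto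
  have hφ : ∀ᶠ x in 𝓝 (0 : ℝ),
      HasDerivAt icoMap (-1728 * icoVertex x ^ 4 * icoEdge x / icoFace x ^ 4) x ∧
        -1728 * icoVertex x ^ 4 * icoEdge x / icoFace x ^ 4 ≠ 0 := by
    filter_upwards [eventually_ico_ne_zero] with x ⟨hf, hv, he⟩
    have := hf.ne'
    exact ⟨hasDerivAt_icoMap hf.ne', by positivity⟩
  have hd1 := eventually_hasDerivAt_comp_inverse hψ hψ0 hright hφ
    (eventually_ico_ne_zero.mono fun x hx => hasDerivAt_icoFace_rpow hx.1)
  have hd2 := eventually_hasDerivAt_comp_inverse hψ hψ0 hright hφ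
    (eventually_ico_ne_zero.mono fun x hx =>
      (hasDerivAt_icoRatio hx.2.1 hx.2.2).mul (hasDerivAt_icoFace_rpow hx.1))
  set h : ℝ → ℝ := (fun t => icoFace t ^ ((-1 : ℝ)/20)) ∘ ψ with hdef
  have hderiv : ∀ᶠ z in 𝓝 (0 : ℝ), deriv h z =
      ((icoRatio * fun t => icoFace t ^ ((-1 : ℝ)/20)) ∘ ψ) z := by
    filter_upwards [hd1, ht.eventually eventually_ico_ne_zero] with z hz ⟨hf, hv, he⟩
    rw [hz.deriv]
    simp only [Function.comp, Pi.mul_apply, icoRatio]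
    have := hf.ne'
    field_simp
    ring
  have hh : AnalyticAt ℝ h 0 := by
    refine AnalyticAt.comp ?_ hψ
    rw [hψ0]
    exact (analyticAt_icoFace.contDiffAt.rpow_const_of_ne (by norm_num [icoFace])).analyticAt
  have hode := eventually_hypgeo_eq (a := 19/60) (b := -1/60) (c := 4/5) hh
    (by simp [hdef, hψ0, icoFace]) (fun n => by positivity) (by
      filter_upwards [hderiv.eventually_nhds, hd2, hright,
        ht.eventually eventually_ico_ne_zero] with z hz1 hz2 hz3 ⟨hf, hv, he⟩
      rw [(EventuallyEq.deriv_eq hz1), hz2.deriv, hz1.self_of_nhds]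
      have key := icoRatio_equation hv hf.ne' he
      rw [hz3] at key
      simp only [hdef, Function.comp, Pi.mul_apply]
      linear_combination (icoFace (ψ z) ^ ((-1 : ℝ)/20)) * key)
  have htφ : Tendsto icoMap (𝓝 0) (𝓝 0) := by
    simpa [h0] using analyticAt_icoMap.continuousAt.tendsto
  filter_upwards [htφ.eventually hode, hleft] with x hx hx'
  rw [hx, hdef, Function.comp, hx']

theorem stmt13 : ∃ ε > 0, ∀ x : ℝ, |x| < ε →
    hypgeo (19/60) (-1/60) (4/5) (1728 * x * (x^2 - 11*x - 1)^5 / (x^4 + 228*x^3 + 494*x^2 - 228*x + 1)^3) =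
      (1 - 228*x + 494*x^2 + 228*x^3 + x^4) ^ ((-1 : ℝ)/20) := by
  obtain ⟨ε, hε, h⟩ := Metric.eventually_nhds_iff.1 eventually_hypgeo_icoMap
  refine ⟨ε, hε, fun x hx => ?_⟩
  have hx' := h (show dist x 0 < ε by simpa using hx)
  rw [show 1 - 228*x + 494*x^2 + 228*x^3 + x^4 = icoFace x by rw [icoFace]; ring]
  exact hx'
end
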